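/- Let d ≥ 1, let A ⊆ ℤ^d be a set of exactly d+2 elements such that A − A generates ℤ^d as an additive group, and let V be a natural number satisfying (V : ℝ) = d! · vol(Δ_A). Then for every natural number h with h + d + 1 < V, |hA| = binom(h + d + 1, d + 1). -/

import Mathlib

open Pointwise MeasureTheory

/-- The `h`-fold sumset `hA` of a set `A` in an additive commutative monoid:
`0A = {0}` and `(n+1)A = A + nA`. -/
def iterSumset {G : Type*} [AddCommMonoid G] (A : Set G) : ℕ → Set G
  | 0 => {0}
  | n + 1 => A + iterSumset A n

theorem aux_simplex_vol (n : ℕ) : ∀ r : ℝ, 0 ≤ r →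
    volume {x : Fin n → ℝ | (∀ i, 0 ≤ x i) ∧ ∑ i, x i ≤ r} =
      ENNReal.ofReal (r ^ n / (n.factorial : ℝ)) := by
  induction n with
  | zero =>
    intro r hr
    have : {x : Fin 0 → ℝ | (∀ i, 0 ≤ x i) ∧ ∑ i, x i ≤ r} = Set.univ := by
      ext x; simp [hr]
    rw [this, volume_pi, Measure.pi_of_empty]; simp
  | succ n ih =>
    intro r hr
    have hmeas : MeasurableSet {x : ℝ × (Fin n → ℝ) | 0 ≤ x.1 ∧ (∀ i, 0 ≤ x.2 i) ∧
        x.1 + ∑ i, x.2 i ≤ r} := by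
      refine IsClosed.measurableSet ?_
      have h1 : IsClosed {x : ℝ × (Fin n → ℝ) | 0 ≤ x.1} := isClosed_le (by fun_prop) (by fun_prop)
      have h2 : IsClosed {x : ℝ × (Fin n → ℝ) | ∀ i, 0 ≤ x.2 i} := by
        simp only [Set.ofPred_forall]
        exact isClosed_iInter fun i => isClosed_le (by fun_prop) (by fun_prop)
      have h3 : IsClosed {x : ℝ × (Fin n → ℝ) | x.1 + ∑ i, x.2 i ≤ r} :=
        isClosed_le (by fun_prop) (by fun_prop)
      exact h1.inter (h2.inter h3)
    have hpre : {x : Fin (n+1) → ℝ | (∀ i, 0 ≤ x i) ∧ ∑ i, x i ≤ r} =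
        (MeasurableEquiv.piFinSuccAbove (fun _ => ℝ) 0) ⁻¹'
        {x : ℝ × (Fin n → ℝ) | 0 ≤ x.1 ∧ (∀ i, 0 ≤ x.2 i) ∧ x.1 + ∑ i, x.2 i ≤ r} := by
      ext x
      simp [Fin.forall_fin_succ, Fin.sum_univ_succ, MeasurableEquiv.piFinSuccAbove,
        Fin.insertNthEquiv, Fin.tail, and_assoc]
    rw [hpre, (volume_preserving_piFinSuccAbove (fun _ : Fin (n+1) => ℝ) 0).measure_preimage
      hmeas.nullMeasurableSet, Measure.volume_eq_prod, Measure.prod_apply hmeas]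
    have hslice : ∀ t : ℝ, volume (Prod.mk t ⁻¹' {x : ℝ × (Fin n → ℝ) | 0 ≤ x.1 ∧
        (∀ i, 0 ≤ x.2 i) ∧ x.1 + ∑ i, x.2 i ≤ r}) =
        (Set.Icc 0 r).indicator (fun t => ENNReal.ofReal ((r - t) ^ n / (n.factorial : ℝ))) t := by
      intro t
      by_cases ht : t ∈ Set.Icc 0 r
      · rw [Set.indicator_of_mem ht, ← ih (r - t) (by linarith [ht.2])]
        congr 1
        ext x
        simp only [Set.mem_preimage, Set.mem_ofPred_eq]
        constructor
        · rintro ⟨_, h, h'⟩; exact ⟨h, by linarith⟩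
        · rintro ⟨h, h'⟩; exact ⟨ht.1, h, by linarith⟩
      · rw [Set.indicator_of_notMem ht]
        convert measure_empty (μ := (volume : Measure (Fin n → ℝ)))
        ext x
        simp only [Set.mem_preimage, Set.mem_ofPred_eq, Set.mem_empty_iff_false, iff_false]
        rintro ⟨h, h', h''⟩
        exact ht ⟨h, by linarith [Finset.sum_nonneg (fun i (_ : i ∈ Finset.univ) => h' i)]⟩
    simp_rw [hslice]
    rw [lintegral_indicator measurableSet_Icc, ← ofReal_integral_eq_lintegral_ofReal]
    · congr 1
      rw [integral_Icc_eq_integral_Ioc, ← intervalIntegral.integral_of_le hr,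
        intervalIntegral.integral_div,
        intervalIntegral.integral_comp_sub_left (fun x => x ^ n) r, integral_pow]
      rw [Nat.factorial_succ]
      push_cast
      have := Nat.factorial_ne_zero n
      field_simp
      simp
    · exact (Continuous.integrableOn_Icc (by fun_prop))
    · filter_upwards [ae_restrict_mem measurableSet_Icc] with t ht
      have : 0 ≤ r - t := by linarith [ht.2]
      simp only [Pi.zero_apply]
      positivity

theorem aux_conv_vol (n : ℕ) (p : Fin (n+1) → Fin n → ℝ) :
    volume (convexHull ℝ (Set.range p)) ≤
      ENNReal.ofReal (|(Matrix.of fun i j => p i.succ j - p 0 j).det| / (n.factorial : ℝ)) := by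
  set M : Matrix (Fin n) (Fin n) ℝ := Matrix.of fun i j => p i.succ j - p 0 j with hM
  set S := {x : Fin n → ℝ | (∀ i, 0 ≤ x i) ∧ ∑ i, x i ≤ 1} with hS
  set L := Matrix.toLin' M.transpose with hL
  have hconv : Convex ℝ S := by
    intro x hx y hy a b ha hb hab
    refine ⟨fun i => ?_, ?_⟩
    · have := hx.1 i
      have := hy.1 i
      simp only [Pi.add_apply, Pi.smul_apply, smul_eq_mul]
      positivity
    · simp only [Pi.add_apply, Pi.smul_apply, smul_eq_mul, Finset.sum_add_distrib,
        ← Finset.mul_sum]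
      nlinarith [hx.2, hy.2]
  have hsub : convexHull ℝ (Set.range p) ⊆ (fun x => p 0 + x) '' (L '' S) := by
    refine convexHull_min ?_ ((hconv.linear_image L).translate (p 0))
    rintro _ ⟨i, rfl⟩
    refine Fin.cases ?_ (fun i => ?_) i
    · exact ⟨0, ⟨0, ⟨by simp, by simp⟩, by simp⟩, by simp⟩
    · refine ⟨p i.succ - p 0, ⟨Pi.single i 1, ⟨fun j => ?_, ?_⟩, ?_⟩, by simp⟩
      · by_cases h : j = i
        · subst h; simp
        · simp [h]
      · simp
      · ext j
        simp [hL, hM]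
  refine (measure_mono hsub).trans ?_
  rw [Set.image_add_left, measure_preimage_add, Measure.addHaar_image_linearMap,
    aux_simplex_vol n 1 zero_le_one, ← ENNReal.ofReal_mul (abs_nonneg _)]
  apply le_of_eq
  congr 1
  rw [hL, LinearMap.det_toLin', Matrix.det_transpose]
  ring

theorem aux_cover {m n : ℕ} (p : Fin (m+1) → Fin n → ℝ) (μ : Fin (m+1) → ℝ)
    (hne : ∃ i, 0 < μ i) (h0 : ∑ i, μ i = 0) (h1 : ∑ i, μ i • p i = 0) :
    convexHull ℝ (Set.range p) ⊆
      ⋃ i ∈ Finset.univ.filter (fun i => 0 < μ i), convexHull ℝ (Set.range (p ∘ i.succAbove)) := by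
  intro x hx
  have hx' : ∃ t : Fin (m+1) → ℝ, (∀ i, 0 ≤ t i) ∧ ∑ i, t i = 1 ∧ ∑ i, t i • p i = x := by
    have hsub : convexHull ℝ (Set.range p) ⊆
        (∑ i, (LinearMap.proj (R := ℝ) (φ := fun _ : Fin (m+1) => ℝ) i).smulRight (p i) :
          (Fin (m+1) → ℝ) →ₗ[ℝ] (Fin n → ℝ)) ''
          stdSimplex ℝ (Fin (m+1)) := by
      refine convexHull_min ?_ ((convex_stdSimplex ℝ _).linear_image _)
      rintro _ ⟨i, rfl⟩
      refine ⟨Pi.single i 1, single_mem_stdSimplex ℝ i, ?_⟩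
      simp [LinearMap.sum_apply, Pi.single_apply]
    obtain ⟨t, ht, rfl⟩ := hsub hx
    exact ⟨t, ht.1, ht.2, by simp [LinearMap.sum_apply]⟩
  obtain ⟨t, ht0, ht1, rfl⟩ := hx'
  obtain ⟨i, hi, hmin⟩ := Finset.exists_min_image (Finset.univ.filter (fun i => 0 < μ i))
    (fun i => t i / μ i) (by obtain ⟨i, hi⟩ := hne; exact ⟨i, by simp [hi]⟩)
  have hi' : 0 < μ i := by simpa using hi
  simp only [Set.mem_iUnion]
  refine ⟨i, hi, ?_⟩
  set s := t i / μ i with hs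
  have hs0 : 0 ≤ s := div_nonneg (ht0 i) hi'.le
  have hz : t i - s * μ i = 0 := by rw [hs]; field_simp; simp
  refine mem_convexHull_of_exists_fintype (fun j => t (i.succAbove j) - s * μ (i.succAbove j))
    (p ∘ i.succAbove) ?_ ?_ (fun j => ⟨j, rfl⟩) ?_
  · intro j
    set k := i.succAbove j
    by_cases hk : 0 < μ k
    · have := hmin k (by simp [hk])
      rw [le_div_iff₀ hk] at this
      linarith
    · have := mul_nonneg hs0 (neg_nonneg.2 (not_lt.1 hk))
      have := ht0 k
      linarith
  · have : ∑ j, (t j - s * μ j) = 1 := by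
      rw [Finset.sum_sub_distrib, ← Finset.mul_sum, h0, ht1]; simp
    rw [Fin.sum_univ_succAbove _ i, hz, zero_add] at this
    exact this
  · have : ∑ j, (t j - s * μ j) • p j = ∑ j, t j • p j := by
      simp_rw [sub_smul, mul_smul]
      rw [Finset.sum_sub_distrib, ← Finset.smul_sum, h1]; simp
    rw [Fin.sum_univ_succAbove _ i, hz, zero_smul, zero_add] at this
    exact this

/-- the simplex determinant omitting vertex `i` -/
def auxD {d : ℕ} (a : Fin (d+2) → Fin d → ℤ) (i : Fin (d+2)) : ℤ :=
  (Matrix.of fun (k j : Fin d) => a (i.succAbove k.succ) j - a (i.succAbove 0) j).det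

/-- bordered matrix -/
def auxM {d : ℕ} (a : Fin (d+2) → Fin d → ℤ) (i : Fin (d+2)) :
    Matrix (Fin (d+2)) (Fin (d+2)) ℤ :=
  Matrix.of fun k => Fin.cons (if k = i then 1 else 0) (Fin.cons 1 (a k))

theorem auxM_det {d : ℕ} (a : Fin (d+2) → Fin d → ℤ) (i : Fin (d+2)) :
    |(auxM a i).det| = |auxD a i| := by
  rw [Matrix.det_succ_column_zero, Finset.sum_eq_single i]
  · have h2 : ((auxM a i).submatrix i.succAbove Fin.succ).det =
        (Matrix.of fun (k : Fin (d+1)) => (Fin.cons (if k = 0 then 1 else 0)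
          (fun j => if k = 0 then a (i.succAbove 0) j else
            a (i.succAbove k) j - a (i.succAbove 0) j) : Fin (d+1) → ℤ)).det := by
      apply Matrix.det_eq_of_forall_row_eq_smul_add_const
        (fun k => if k = 0 then 0 else 1) 0 (by simp)
      intro k j
      refine Fin.cases ?_ (fun j => ?_) j
      · by_cases hk : k = 0 <;> simp [auxM, hk]
      · by_cases hk : k = 0 <;> simp [auxM, hk]
    rw [h2, Matrix.det_succ_column_zero, Finset.sum_eq_single 0]
    · simp only [auxM, abs_mul]
      simp [auxD]
      congr 2
    · intro b _ hb; simp [hb]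
    · simp
  · intro b _ hb; simp [auxM, hb]
  · simp

theorem aux_dvd {d : ℕ} (a : Fin (d+2) → Fin d → ℤ)
    (hgen : ∀ v : Fin d → ℤ, ∃ c : Fin (d+2) → ℤ, ∑ k, c k = 0 ∧ ∑ k, c k • a k = v)
    (μ : Fin (d+2) → ℤ) (h0 : ∑ k, μ k = 0) (h1 : ∑ k, μ k • a k = 0) (i : Fin (d+2)) :
    auxD a i ∣ μ i := by
  choose c hc0 hc1 using hgen
  -- row with sum 1 and zero combination
  set C : Matrix (Fin (d+2)) (Fin (d+2)) ℤ := Matrix.of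
    (Fin.cons μ (Fin.cons (Pi.single 0 1 - c (a 0)) (fun j => c (Pi.single j 1)))) with hC
  have hone : ∀ r, (C * auxM a i) r 1 = ∑ k, C r k := by
    intro r
    simp only [Matrix.mul_apply]
    apply Finset.sum_congr rfl
    intro k _
    have : auxM a i k 1 = 1 := rfl
    rw [this, mul_one]
  have hrest : ∀ r (j : Fin d), (C * auxM a i) r j.succ.succ = (∑ k, C r k • a k) j := by
    intro r j
    simp only [Matrix.mul_apply, Finset.sum_apply, Pi.smul_apply, smul_eq_mul]
    rfl
  have hmul : (C * auxM a i).det = μ i := by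
    have h00 : (C * auxM a i) 0 0 = μ i := by
      simp [Matrix.mul_apply, auxM, hC]
    rw [Matrix.det_succ_row_zero, Finset.sum_eq_single 0]
    · have : (C * auxM a i).submatrix Fin.succ (Fin.succAbove 0) = 1 := by
        ext r s
        simp only [Matrix.submatrix_apply, Fin.zero_succAbove]
        refine Fin.cases ?_ (fun s => ?_) s
        · have := hone r.succ
          rw [show (Fin.succ 0 : Fin (d+2)) = 1 from rfl, this]
          refine Fin.cases ?_ (fun r => ?_) r
          · simp [hC, hc0]
          · simp [hC, hc0, Matrix.one_apply]
        · rw [hrest]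
          refine Fin.cases ?_ (fun r => ?_) r
          · simp only [hC, Matrix.of_apply, Fin.cons_succ, Fin.cons_zero, Pi.sub_apply, sub_smul,
              Finset.sum_sub_distrib, hc1]
            have hz : ∑ k : Fin (d+2), (Pi.single 0 1 : Fin (d+2) → ℤ) k • a k = a 0 := by
              simp [Pi.single_apply, ite_smul]
            rw [hz]
            simp [Matrix.one_apply, (Fin.succ_ne_zero s).symm]
          · simp only [hC, Matrix.of_apply, Fin.cons_succ, hc1]
            simp [Pi.single_apply, Matrix.one_apply, eq_comm]
      rw [this, h00]; simp
    · intro b _ hb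
      obtain ⟨b, rfl⟩ := Fin.exists_succ_eq.2 hb
      have : (C * auxM a i) 0 b.succ = 0 := by
        refine Fin.cases ?_ (fun s => ?_) b
        · rw [show (Fin.succ 0 : Fin (d+2)) = 1 from rfl, hone]
          simpa [hC] using h0
        · rw [hrest]
          have : ∑ k, C 0 k • a k = 0 := by simpa [hC] using h1
          rw [this]; rfl
      rw [this]; simp
    · simp
  rw [Matrix.det_mul] at hmul
  rw [← abs_dvd, ← auxM_det, abs_dvd, ← hmul]
  exact dvd_mul_left _ _

theorem aux_gen {d : ℕ} (a : Fin (d+2) → Fin d → ℤ)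
    (hgen : AddSubgroup.closure (Set.range a - Set.range a) = ⊤) :
    ∀ v : Fin d → ℤ, ∃ c : Fin (d+2) → ℤ, ∑ k, c k = 0 ∧ ∑ k, c k • a k = v := by
  intro v
  have hv : v ∈ AddSubgroup.closure (Set.range a - Set.range a) := by rw [hgen]; trivial
  induction hv using AddSubgroup.closure_induction with
  | mem x hx =>
    obtain ⟨_, ⟨i, rfl⟩, _, ⟨j, rfl⟩, rfl⟩ := hx
    refine ⟨Pi.single i 1 - Pi.single j 1, by simp, ?_⟩
    simp [sub_smul, Pi.single_apply, ite_smul]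
  | zero => exact ⟨0, by simp, by simp⟩
  | add x y _ _ hx hy =>
    obtain ⟨c, h0, rfl⟩ := hx
    obtain ⟨c', h0', rfl⟩ := hy
    exact ⟨c + c', by simp [Finset.sum_add_distrib, h0, h0'],
      by simp [add_smul, Finset.sum_add_distrib]⟩
  | neg x _ hx =>
    obtain ⟨c, h0, rfl⟩ := hx
    exact ⟨-c, by simp [h0], by simp⟩

theorem aux_sumset {d n : ℕ} (a : Fin n → Fin d → ℤ) (h : ℕ) :
    iterSumset (Set.range a) h =
      (fun m : Fin n → ℕ => ∑ k, m k • a k) '' {m | ∑ k, m k = h} := by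
  induction h with
  | zero =>
    ext x
    simp only [iterSumset, Set.mem_singleton_iff, Set.mem_image, Set.mem_ofPred_eq]
    constructor
    · rintro rfl; exact ⟨0, by simp, by simp⟩
    · rintro ⟨m, hm, rfl⟩
      have : ∀ k, m k = 0 := by simpa using hm
      simp [this]
  | succ h ih =>
    rw [iterSumset, ih]
    ext x
    constructor
    · rintro ⟨_, ⟨i, rfl⟩, _, ⟨m, hm, rfl⟩, rfl⟩
      refine ⟨Pi.single i 1 + m, ?_, ?_⟩
      · have hm' : ∑ k, m k = h := hm
        simp [Finset.sum_add_distrib, hm', add_comm]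
      · simp [add_smul, Finset.sum_add_distrib, Pi.single_apply, ite_smul]
    · rintro ⟨m, hm, rfl⟩
      have hm' : ∑ k, m k = h + 1 := hm
      obtain ⟨i, hi⟩ : ∃ i, m i ≠ 0 := by
        by_contra hcon
        push Not at hcon
        simp [hcon] at hm'
      have hdec : m = Pi.single i 1 + (m - Pi.single i 1) := by
        ext k
        by_cases hk : k = i
        · subst hk; simp; omega
        · simp [hk]
      refine ⟨a i, ⟨i, rfl⟩, _, ⟨m - Pi.single i 1, ?_, rfl⟩, ?_⟩
      · rw [hdec] at hm'
        simp only [Pi.add_apply, Finset.sum_add_distrib] at hm'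
        simp only [Finset.sum_pi_single', Finset.mem_univ, if_true] at hm'
        change ∑ k, (m - Pi.single i 1 : Fin n → ℕ) k = h
        omega
      · conv_rhs => rw [hdec]
        simp only [Pi.add_apply, add_smul, Finset.sum_add_distrib]
        simp [Pi.single_apply, ite_smul]

theorem aux_vol_le {d : ℕ} (a : Fin (d+2) → Fin d → ℤ)
    (hgen : ∀ v : Fin d → ℤ, ∃ c : Fin (d+2) → ℤ, ∑ k, c k = 0 ∧ ∑ k, c k • a k = v)
    (μ : Fin (d+2) → ℤ) (hne : μ ≠ 0) (h0 : ∑ k, μ k = 0) (h1 : ∑ k, μ k • a k = 0) :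
    (d.factorial : ℝ) * (volume (convexHull ℝ
      (Set.range (fun k => fun i => (a k i : ℝ))))).toReal ≤
      ∑ k ∈ Finset.univ.filter (fun k => 0 < μ k), (μ k : ℝ) := by
  set p : Fin (d+2) → Fin d → ℝ := fun k i => (a k i : ℝ) with hp
  have hpos : ∃ i, 0 < μ i := by
    by_contra hcon
    push Not at hcon
    apply hne
    have := (Finset.sum_eq_zero_iff_of_nonpos (fun i _ => hcon i)).1 h0
    ext i; exact this i (Finset.mem_univ i)
  have hcov := aux_cover p (fun k => (μ k : ℝ)) (by simpa using hpos)
    (by exact_mod_cast h0) (by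
      ext j
      have := congrFun h1 j
      simp only [Finset.sum_apply, Pi.smul_apply, smul_eq_mul, Pi.zero_apply] at this
      simp only [Finset.sum_apply, Pi.smul_apply, smul_eq_mul, Pi.zero_apply, hp]
      exact_mod_cast this)
  simp only [Int.cast_pos] at hcov
  have hfac : (0 : ℝ) < d.factorial := by exact_mod_cast Nat.factorial_pos d
  have hle : volume (convexHull ℝ (Set.range p)) ≤
      ENNReal.ofReal (∑ k ∈ Finset.univ.filter (fun k => 0 < μ k), (μ k : ℝ) / d.factorial) := by
    refine (measure_mono hcov).trans ((measure_biUnion_finset_le _ _).trans ?_)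
    rw [ENNReal.ofReal_sum_of_nonneg]
    · apply Finset.sum_le_sum
      intro k hk
      have hk' : 0 < μ k := by simpa using hk
      refine (aux_conv_vol d _).trans (ENNReal.ofReal_le_ofReal ?_)
      have : (Matrix.of fun i j => (p ∘ k.succAbove) i.succ j - (p ∘ k.succAbove) 0 j).det
          = ((auxD a k : ℤ) : ℝ) := by
        rw [auxD, Int.cast_det]
        congr 1
        ext i j
        simp [hp]
      rw [this]
      gcongr
      have h2 := aux_dvd a hgen μ h0 h1 k
      have := Int.le_of_dvd hk' ((abs_dvd _ _).2 h2)
      exact_mod_cast this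
    · intro k hk
      have hk' : 0 < μ k := by simpa using hk
      have : (0 : ℝ) < μ k := by exact_mod_cast hk'
      positivity
  rw [← Finset.sum_div] at hle
  have h3 := ENNReal.toReal_le_of_le_ofReal (div_nonneg (Finset.sum_nonneg (by
    intro k hk
    have hk' : 0 < μ k := by simpa using hk
    exact_mod_cast hk'.le)) hfac.le) hle
  rw [le_div_iff₀ hfac] at h3
  linarith

theorem size_dplus2_small_h (d : ℕ) (hd : 1 ≤ d) (A : Set (Fin d → ℤ))
    (hfin : A.Finite) (hcard : A.ncard = d + 2)
    (hgen : AddSubgroup.closure (A - A) = ⊤)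
    (V : ℕ)
    (hV : (V : ℝ) = (Nat.factorial d : ℝ) *
      (volume (convexHull ℝ ((fun (v : Fin d → ℤ) (i : Fin d) => (v i : ℝ)) '' A))).toReal) :
    ∀ h : ℕ, h + d + 1 < V →
      (iterSumset A h).ncard = Nat.choose (h + d + 1) (d + 1) := by
  intro h hh
  obtain ⟨a, rfl⟩ : ∃ a : Fin (d+2) → Fin d → ℤ, A = Set.range a := by
    have : Finite A := hfin
    have e : A ≃ Fin (d+2) := Finite.equivFinOfCardEq (by rw [Nat.card_coe_set_eq, hcard])
    refine ⟨fun k => (e.symm k : Fin d → ℤ), ?_⟩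
    have := (e.symm.surjective.range_comp (Subtype.val : A → Fin d → ℤ))
    rw [Subtype.range_val] at this
    exact this.symm
  rw [← Set.range_comp] at hV
  have hinj : Set.InjOn (fun m : Fin (d+2) → ℕ => ∑ k, m k • a k) {m | ∑ k, m k = h} := by
    intro m hm m' hm' heq
    by_contra hne
    have hm1 : ∑ k, m k = h := hm
    have hm2 : ∑ k, m' k = h := hm'
    have heq' : ∑ k, m k • a k = ∑ k, m' k • a k := heq
    have key := aux_vol_le a (aux_gen a hgen) (fun k => (m k : ℤ) - m' k) (by
        intro h0
        apply hne
        ext k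
        have := congrFun h0 k
        simp only [Pi.zero_apply] at this
        omega) (by
        rw [Finset.sum_sub_distrib, ← Nat.cast_sum, ← Nat.cast_sum, hm1, hm2, sub_self]) (by
        simp only [sub_smul, Finset.sum_sub_distrib, natCast_zsmul]
        rw [heq', sub_self])
    have hV' : (V : ℝ) ≤ ∑ k ∈ Finset.univ.filter (fun k => (0 : ℤ) < (m k : ℤ) - m' k),
        (((m k : ℤ) - m' k : ℤ) : ℝ) := by
      rw [hV]; exact key
    have hle : ∑ k ∈ Finset.univ.filter (fun k => (0 : ℤ) < (m k : ℤ) - m' k),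
        (((m k : ℤ) - m' k : ℤ) : ℝ) ≤ ∑ k, (m k : ℝ) := by
      refine (Finset.sum_le_sum (g := fun k => (m k : ℝ)) ?_).trans
        (Finset.sum_le_sum_of_subset_of_nonneg (Finset.filter_subset _ _) (by simp))
      intro k _
      push_cast
      have : (0 : ℝ) ≤ m' k := by positivity
      linarith
    rw [← Nat.cast_sum, hm1] at hle
    have : V ≤ h := by exact_mod_cast hV'.trans hle
    omega
  rw [aux_sumset, hinj.ncard_image, ← Nat.card_coe_set_eq]
  have := Nat.card_congr (Sym.equivNatSumOfFintype (Fin (d+2)) h)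
  rw [Nat.card_eq_fintype_card, Sym.card_sym_eq_choose, Fintype.card_fin] at this
  refine this.symm.trans ?_
  rw [show d + 2 + h - 1 = h + d + 1 by omega]
  rw [← Nat.choose_symm_of_eq_add (show h + d + 1 = (d+1) + h by omega)]
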